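/- For the free Lie algebra over ℚ on a graded vector space W concentrated in a single even degree with dim W = m, the dimension of the bracket-length-n component is given by the Witt formula: (1/n) Σ_{d | n} μ(d) m^{n/d}, where μ is the Möbius function. -/

import Mathlib

/-- The left-normed iterated bracket `[x_{a}, x_{l₁}, …, x_{l_r}]` of generators of the
free Lie algebra over `ℚ` on `Fin m`. -/
noncomputable def freeLieBracket (m : ℕ) : Fin m → List (Fin m) → FreeLieAlgebra ℚ (Fin m)
  | a, [] => FreeLieAlgebra.of ℚ a
  | a, b :: t => ⁅FreeLieAlgebra.of ℚ a, freeLieBracket m b t⁆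

/-- The bracket-length-`n` homogeneous component of the free Lie algebra on `m`
generators: the span of all left-normed brackets of exactly `n` generators. -/
noncomputable def freeLieHomog (m n : ℕ) : Submodule ℚ (FreeLieAlgebra ℚ (Fin m)) :=
  Submodule.span ℚ
    {z | ∃ (a : Fin m) (l : List (Fin m)), l.length + 1 = n ∧ z = freeLieBracket m a l}

namespace WittAux

section Comb
variable {α : Type*} [LinearOrder α]

lemma app_lt_iff (s : List α) {a b : List α} : s ++ a < s ++ b ↔ a < b := by
  induction s with
  | nil => simp
  | cons x s ih => simp [ih]

lemma lt_dichot : ∀ {u v : List α}, u < v →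
    (∃ t, t ≠ [] ∧ v = u ++ t) ∨ (∀ a b, u ++ a < v ++ b)
  | [], v, h => by
    left
    refine ⟨v, ?_, by simp⟩
    rintro rfl
    simp at h
  | x :: u, [], h => by simp at h
  | x :: u, y :: v, h => by
    rw [List.cons_lt_cons_iff] at h
    rcases h with h | ⟨rfl, h⟩
    · right
      intro a b
      simp only [List.cons_append, List.cons_lt_cons_iff]
      exact Or.inl h
    · rcases lt_dichot h with ⟨t, ht, rfl⟩ | h'
      · left
        exact ⟨t, ht, by simp⟩
      · right
        intro a b
        simpa using h' a b

lemma lt_app_of_length_le {u v : List α} (h : u < v) (hl : v.length ≤ u.length) (a b : List α) :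
    u ++ a < v ++ b := by
  rcases lt_dichot h with ⟨t, ht, rfl⟩ | h'
  · simp at hl
    exact absurd hl ht
  · exact h' a b

def IsLyndon (w : List α) : Prop :=
  w ≠ [] ∧ ∀ u v, w = u ++ v → v ≠ [] → w ≤ v

lemma IsLyndon.lt {w u v : List α} (h : IsLyndon w) (e : w = u ++ v) (hu : u ≠ []) (hv : v ≠ []) :
    w < v := by
  refine lt_of_le_of_ne (h.2 u v e hv) ?_
  intro e'
  have := congrArg List.length e
  rw [e'] at this
  simp at this
  exact hu this

lemma IsLyndon.lt_rot {w u v : List α} (h : IsLyndon w) (e : w = u ++ v) (hu : u ≠ [])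
    (hv : v ≠ []) : u ++ v < v ++ u := by
  have h1 := h.lt e hu hv
  have := lt_app_of_length_le h1 (by simp [e]) [] u
  rw [e] at this
  simpa using this

/-- Lyndon words are those strictly smaller than their proper rotations. -/
lemma isLyndon_iff {w : List α} :
    IsLyndon w ↔ w ≠ [] ∧ ∀ u v, w = u ++ v → u ≠ [] → v ≠ [] → u ++ v < v ++ u := by
  constructor
  · intro h
    exact ⟨h.1, fun u v e hu hv => h.lt_rot e hu hv⟩
  · rintro ⟨h0, h⟩
    refine ⟨h0, fun u v e hv => ?_⟩
    by_contra hlt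
    rw [not_le] at hlt
    have hu : u ≠ [] := by
      rintro rfl
      simp at e
      rw [e] at hlt
      exact lt_irrefl _ hlt
    have h1 := h u v e hu hv
    rcases lt_dichot hlt with ⟨t, ht, e2⟩ | h'
    · have e3 : u ++ v = v ++ t := by rw [← e, ← e2]
      have hl : t.length = u.length := by
        have := congrArg List.length e3
        simp at this
        omega
      rw [e3, app_lt_iff] at h1
      have h2 := h v t e2 hv ht
      rw [← e3] at h2
      have h3 := lt_app_of_length_le h1 (by omega) v v
      exact lt_asymm h2 h3
    · have := h' u []
      rw [List.append_nil, e] at this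
      exact lt_asymm this h1

/-- A least nonempty suffix satisfying the side condition. -/
lemma exists_min_suffix (w : List α) (P : List α → Prop) (hP : ∃ u v, w = u ++ v ∧ P v) :
    ∃ u v, w = u ++ v ∧ P v ∧ ∀ u' v', w = u' ++ v' → P v' → v ≤ v' := by
  classical
  let S : Finset (List α) := w.tails.toFinset.filter P
  have hS : S.Nonempty := by
    obtain ⟨u, v, e, hv⟩ := hP
    exact ⟨v, by simp [S, hv, e]⟩
  obtain ⟨v, hv, hmin⟩ := S.exists_min_image id hS
  simp only [S, Finset.mem_filter, List.mem_toFinset, List.mem_tails] at hv hmin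
  obtain ⟨⟨u, e⟩, hv'⟩ := hv
  refine ⟨u, v, e.symm, hv', ?_⟩
  intro u' v' e' hv''
  exact hmin v' ⟨⟨u', e'.symm⟩, hv''⟩

lemma IsLyndon.factor {w : List α} (h : IsLyndon w) (hl : 2 ≤ w.length) :
    ∃ u v, w = u ++ v ∧ IsLyndon u ∧ IsLyndon v ∧ u ++ v < v ++ u := by
  obtain ⟨u, v, e, ⟨hv0, hv⟩, hmin⟩ := exists_min_suffix w
    (fun v => v ≠ [] ∧ v.length < w.length) (by
      obtain ⟨a, b, w', rfl⟩ : ∃ a b w', w = a :: b :: w' := by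
        match w, hl with
        | a :: b :: w', _ => exact ⟨a, b, w', rfl⟩
      exact ⟨[a], b :: w', by simp, by simp, by simp⟩)
  have hu0 : u ≠ [] := by
    rintro rfl
    simp [e] at hv
  refine ⟨u, v, e, ⟨hu0, ?_⟩, ⟨hv0, ?_⟩, h.lt_rot e hu0 hv0⟩
  · intro s t e2 ht
    by_contra hlt
    rw [not_le] at hlt
    have h1 : w ≤ t ++ v := h.2 s (t ++ v) (by rw [e, e2, List.append_assoc]) (by simp [ht])
    rcases lt_dichot hlt with ⟨r, hr, e3⟩ | h'
    · rw [e, e3, List.append_assoc] at h1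
      have h2 : ¬ v < r ++ v := by
        intro h2
        exact absurd h1 (not_le.mpr ((app_lt_iff t).mpr h2))
      have h3 : v ≤ r ++ v := by
        refine hmin t (r ++ v) (by rw [e, e3, List.append_assoc]) ⟨by simp [hr], ?_⟩
        rw [e, e3]
        have := List.length_pos_iff.mpr ht
        simp
        omega
      have h4 : v = r ++ v := le_antisymm h3 (not_lt.mp h2)
      have := congrArg List.length h4
      simp at this
      exact hr this
    · have := h' v v
      rw [← e] at this
      exact absurd h1 (not_le.mpr this)
  · intro s t e2 ht
    refine hmin (u ++ s) t (by rw [e, e2, List.append_assoc]) ⟨ht, ?_⟩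
    have : t.length ≤ v.length := by simp [e2]
    omega

/-- All ways to write a word as a shuffle. -/
def splits {α : Type*} : List α → List (List α × List α)
  | [] => [([], [])]
  | x :: w => (splits w).map (fun p => (x :: p.1, p.2)) ++ (splits w).map (fun p => (p.1, x :: p.2))

lemma mem_splits_cons {x : α} {z s t : List α} : (s, t) ∈ splits (x :: z) ↔
    (∃ s', s = x :: s' ∧ (s', t) ∈ splits z) ∨ (∃ t', t = x :: t' ∧ (s, t') ∈ splits z) := by
  simp only [splits, List.mem_append, List.mem_map, Prod.mk.injEq, Prod.exists]
  constructor
  · rintro (⟨a, b, h, rfl, rfl⟩ | ⟨a, b, h, rfl, rfl⟩)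
    · exact Or.inl ⟨a, rfl, h⟩
    · exact Or.inr ⟨b, rfl, h⟩
  · rintro (⟨a, rfl, h⟩ | ⟨b, rfl, h⟩)
    · exact Or.inl ⟨a, t, h, rfl, rfl⟩
    · exact Or.inr ⟨s, b, h, rfl, rfl⟩

lemma splits_nil_left (t : List α) : ([], t) ∈ splits t := by
  induction t with
  | nil => simp [splits]
  | cons x t ih => exact mem_splits_cons.mpr (Or.inr ⟨t, rfl, ih⟩)

lemma splits_append (s t : List α) : (s, t) ∈ splits (s ++ t) := by
  induction s with
  | nil => exact splits_nil_left t
  | cons x s ih => exact mem_splits_cons.mpr (Or.inl ⟨s, rfl, ih⟩)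

lemma splits_nil_eq {z t : List α} (h : ([], t) ∈ splits z) : z = t := by
  induction z generalizing t with
  | nil => simpa [splits, eq_comm] using h
  | cons x z ih =>
    rcases mem_splits_cons.mp h with ⟨s', e, _⟩ | ⟨t', rfl, h'⟩
    · simp at e
    · rw [ih h']

lemma reflect (z : List α) : ∀ r S T : List α, T ≤ S → (r ++ S, T) ∈ splits z →
    ∃ z', (S, r ++ T) ∈ splits z' ∧ z ≤ z' := by
  induction z with
  | nil =>
    intro r S T _ h
    simp [splits] at h
    obtain ⟨⟨rfl, rfl⟩, rfl⟩ := h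
    exact ⟨[], by simp [splits], le_rfl⟩
  | cons x z ih =>
    intro r S T hST h
    match r with
    | [] => exact ⟨x :: z, by simpa using h, le_rfl⟩
    | y :: r1 =>
      rcases mem_splits_cons.mp h with ⟨s', e, h'⟩ | ⟨T1, rfl, h'⟩
      · simp at e
        obtain ⟨rfl, rfl⟩ := e
        obtain ⟨z', hz', hle⟩ := ih r1 S T hST h'
        exact ⟨y :: z', mem_splits_cons.mpr (Or.inr ⟨r1 ++ T, by simp, hz'⟩),
          List.cons_le_cons _ hle⟩
      · match S, hST with
        | [], hST => 
          exfalso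
          rcases lt_or_eq_of_le hST with h | h <;> simp at h
        | y' :: S1, hST =>
          by_cases hxy : x = y'
          · subst hxy
            have hle : T1 ≤ S1 := by
              rw [← not_lt] at hST ⊢
              intro hlt
              exact hST (by simpa using hlt)
            obtain ⟨z', hz', hle'⟩ := ih (y :: r1 ++ [x]) S1 T1 hle (by simpa using h')
            exact ⟨x :: z', mem_splits_cons.mpr (Or.inl ⟨S1, rfl, by simpa using hz'⟩),
              List.cons_le_cons _ hle'⟩
          · have hlt : x < y' := by
              rcases lt_or_eq_of_le hST with h | h
              · rw [List.cons_lt_cons_iff] at h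
                rcases h with h | ⟨h, _⟩
                · exact h
                · exact absurd h hxy
              · simp at h
                exact absurd h.1 hxy
            refine ⟨(y' :: S1) ++ (y :: r1 ++ x :: T1), splits_append _ _, le_of_lt ?_⟩
            simp [List.cons_lt_cons_iff, hlt]

lemma shuffle_le (T : List α) (S : List α) (hS : ∀ a b, S = a ++ b → b ≠ [] → T ≤ b) :
    ∀ z, (S, T) ∈ splits z → z ≤ S ++ T := by
  induction S with
  | nil => intro z h; rw [splits_nil_eq h]; simp
  | cons x S ih =>
    have ih := ih (fun a b e hb => hS (x :: a) b (by simp [e]) hb)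
    intro z h
    match z, h with
    | [], h => simp [splits] at h
    | y :: z, h =>
      rcases mem_splits_cons.mp h with ⟨s', e, h'⟩ | ⟨T1, rfl, h'⟩
      · simp at e
        obtain ⟨rfl, rfl⟩ := e
        exact List.cons_le_cons _ (ih z h')
      · have hle := hS [] (x :: S) rfl (by simp)
        by_cases hxy : y = x
        · subst hxy
          have hle : T1 ≤ S := by
            rw [← not_lt] at hle ⊢
            intro hlt
            exact hle (by simpa using hlt)
          obtain ⟨z', hz', hle'⟩ := reflect z [y] S T1 hle (by simpa using h')
          exact List.cons_le_cons _ (hle'.trans (ih z' hz'))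
        · have hlt : y < x := by
            rcases lt_or_eq_of_le hle with h | h
            · rw [List.cons_lt_cons_iff] at h
              rcases h with h | ⟨h, _⟩
              · exact h
              · exact absurd h hxy
            · simp at h
              exact absurd h.1 hxy
          apply le_of_lt
          simp [List.cons_lt_cons_iff, hlt]

/-- A non-Lyndon word is the largest shuffle of two nonempty words. -/
lemma exists_shuffle {w : List α} (h0 : w ≠ []) (hw : ¬ IsLyndon w) :
    ∃ u v, u ≠ [] ∧ v ≠ [] ∧ w = u ++ v ∧ ∀ z, (u, v) ∈ splits z → z ≤ w := by
  obtain ⟨u, v, e, hv, hmin⟩ := exists_min_suffix w (fun v => v ≠ []) ⟨[], w, by simp, h0⟩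
  have hu : u ≠ [] := by
    rintro rfl
    simp at e
    subst e
    exact hw ⟨h0, hmin⟩
  refine ⟨u, v, hu, hv, e, ?_⟩
  rw [e]
  apply shuffle_le
  intro a b e2 hb
  by_contra hlt
  rw [not_le] at hlt
  have h1 : v ≤ b ++ v := hmin a (b ++ v) (by rw [e, e2, List.append_assoc]) (by simp [hv])
  rcases lt_dichot hlt with ⟨t, ht, e3⟩ | h'
  · have h2 : v ≤ t := hmin (u ++ b) t (by rw [List.append_assoc, ← e3, e]) ht
    have h3 : ¬ v < t := by
      intro h3
      have := (app_lt_iff b).mpr h3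
      rw [← e3] at this
      exact absurd h1 (not_le.mpr this)
    have h4 : v = t := le_antisymm h2 (not_lt.mp h3)
    have := congrArg List.length e3
    rw [h4] at this
    simp at this
    exact hb this
  · have := h' v []
    rw [List.append_nil] at this
    exact absurd h1 (not_le.mpr this)

end Comb
end WittAux
namespace WittAux

section Alg

attribute [local instance] LieRing.ofAssociativeRing

open FreeMonoid (ofList toList)

/-- The free associative algebra, as a monoid algebra on words. -/
abbrev T (m : ℕ) := MonoidAlgebra ℚ (FreeMonoid (Fin m))

/-- Words in two commuting sets of letters. -/
abbrev T2 (m : ℕ) := MonoidAlgebra ℚ (FreeMonoid (Fin m) × FreeMonoid (Fin m))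

variable {m : ℕ}

/-- Coefficient at a word. -/
noncomputable def cf (w : List (Fin m)) : T m →ₗ[ℚ] ℚ :=
  Finsupp.lapply (ofList w) ∘ₗ (MonoidAlgebra.coeffLinearEquiv ℚ).toLinearMap

lemma cf_apply (w : List (Fin m)) (t : T m) : cf w t = t.coeff (ofList w) := rfl

lemma exists_cf_ne {t : T m} (h : t ≠ 0) : ∃ w, cf w t ≠ 0 := by
  by_contra! hc
  apply h
  ext w
  exact hc (toList w)

/-- Homogeneity. -/
def Hom (n : ℕ) (t : T m) : Prop := ∀ w, cf w t ≠ 0 → w.length = n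

lemma cf_mul {p : ℕ} {s : T m} (hs : Hom p s) (t : T m) (u v : List (Fin m)) (hu : u.length = p) :
    cf (u ++ v) (s * t) = cf u s * cf v t := by
  classical
  rw [cf_apply, MonoidAlgebra.coeff_mul, Finsupp.sum, Finset.sum_eq_single (ofList u)]
  · rw [Finsupp.sum, Finset.sum_eq_single (ofList v)]
    · simp [cf_apply]
    · intro b _ hb
      rw [if_neg]
      intro e
      apply hb
      have e' : u ++ toList b = u ++ v := e
      exact List.append_cancel_left e'
    · intro hv
      simp at hv
      simp [hv]
  · intro a ha hne
    apply Finset.sum_eq_zero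
    intro b _
    apply if_neg
    intro e
    apply hne
    have e' : toList a ++ toList b = u ++ v := e
    have hl : (toList a).length = p := hs (toList a) (by simpa [cf_apply] using ha)
    exact (List.append_inj e' (by rw [hl, hu])).1
  · intro hu
    simp at hu
    simp [hu]

lemma Hom.mul {p q : ℕ} {s t : T m} (hs : Hom p s) (ht : Hom q t) : Hom (p + q) (s * t) := by
  classical
  intro w hw
  have h1 : ofList w ∈ (s * t).coeff.support := by simpa [cf_apply] using hw
  have h2 := MonoidAlgebra.support_coeff_mul_subset _ _ h1
  rw [Finset.mem_mul] at h2
  obtain ⟨a, ha, b, hb, e⟩ := h2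
  have e' : toList a ++ toList b = w := e
  rw [← e', List.length_append, hs (toList a) (by simpa [cf_apply] using ha),
    ht (toList b) (by simpa [cf_apply] using hb)]

lemma Hom.sub {p : ℕ} {s t : T m} (hs : Hom p s) (ht : Hom p t) : Hom p (s - t) := by
  intro w hw
  rw [map_sub] at hw
  by_cases h : cf w s = 0
  · exact ht w (by intro h'; simp [h, h'] at hw)
  · exact hs w h

lemma Hom.add {p : ℕ} {s t : T m} (hs : Hom p s) (ht : Hom p t) : Hom p (s + t) := by
  intro w hw
  rw [map_add] at hw
  by_cases h : cf w s = 0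
  · exact ht w (by intro h'; simp [h, h'] at hw)
  · exact hs w h

lemma Hom.smul {p : ℕ} {s : T m} (r : ℚ) (hs : Hom p s) : Hom p (r • s) := by
  intro w hw
  rw [map_smul] at hw
  exact hs w (by intro h'; simp [h'] at hw)

noncomputable def lt (a : Fin m) : T m := MonoidAlgebra.single (FreeMonoid.of a) 1

lemma cf_lt (a : Fin m) (w : List (Fin m)) : cf w (lt a) = if w = [a] then 1 else 0 := by
  classical
  rw [cf_apply, lt, MonoidAlgebra.coeff_single, Finsupp.single_apply]
  congr 1
  exact propext ⟨fun h => h.symm, fun h => h.symm⟩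

lemma hom_lt (a : Fin m) : Hom 1 (lt a) := by
  intro w hw
  rw [cf_lt] at hw
  split_ifs at hw with h
  · simp [h]
  · simp at hw

/-- The canonical map to the associative algebra. -/
noncomputable def io (m : ℕ) : FreeLieAlgebra ℚ (Fin m) →ₗ⁅ℚ⁆ T m :=
  FreeLieAlgebra.lift ℚ (fun a => lt a)

@[simp] lemma io_of (a : Fin m) : io m (FreeLieAlgebra.of ℚ a) = lt a := by
  simp [io]

lemma io_lie (x y : FreeLieAlgebra ℚ (Fin m)) : io m ⁅x, y⁆ = io m x * io m y - io m y * io m x := by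
  rw [LieHom.map_lie, LieRing.of_associative_ring_bracket]

lemma br_mem (a : Fin m) (l : List (Fin m)) : freeLieBracket m a l ∈ freeLieHomog m (l.length + 1) :=
  Submodule.subset_span ⟨a, l, rfl, rfl⟩

lemma of_lie_mem (a : Fin m) {q : ℕ} {z : FreeLieAlgebra ℚ (Fin m)} (hz : z ∈ freeLieHomog m q) :
    ⁅FreeLieAlgebra.of ℚ a, z⁆ ∈ freeLieHomog m (1 + q) := by
  induction hz using Submodule.span_induction with
  | mem x h =>
    obtain ⟨b, l, rfl, rfl⟩ := h
    have := br_mem a (b :: l)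
    rw [freeLieBracket] at this
    rwa [add_comm]
  | zero => simp
  | add x y _ _ hx hy => rw [lie_add]; exact Submodule.add_mem _ hx hy
  | smul r x _ hx => rw [lie_smul]; exact Submodule.smul_mem _ _ hx

lemma br_lie_mem (l : List (Fin m)) : ∀ (a : Fin m) {q : ℕ} {z : FreeLieAlgebra ℚ (Fin m)},
    z ∈ freeLieHomog m q → ⁅freeLieBracket m a l, z⁆ ∈ freeLieHomog m (l.length + 1 + q) := by
  induction l with
  | nil =>
    intro a q z hz
    simpa [freeLieBracket] using of_lie_mem a hz
  | cons b t ih =>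
    intro a q z hz
    rw [freeLieBracket, lie_lie]
    have h1 := of_lie_mem a (ih b hz)
    have h2 := ih b (of_lie_mem a hz)
    apply Submodule.sub_mem
    · convert h1 using 2
      simp only [List.length_cons]
      omega
    · convert h2 using 2
      simp only [List.length_cons]
      omega

lemma lie_mem {p q : ℕ} {y z : FreeLieAlgebra ℚ (Fin m)} (hy : y ∈ freeLieHomog m p)
    (hz : z ∈ freeLieHomog m q) : ⁅y, z⁆ ∈ freeLieHomog m (p + q) := by
  induction hy using Submodule.span_induction with
  | mem x h =>
    obtain ⟨b, l, rfl, rfl⟩ := h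
    exact br_lie_mem l b hz
  | zero => simp
  | add x y _ _ hx hy => rw [add_lie]; exact Submodule.add_mem _ hx hy
  | smul r x _ hx => rw [smul_lie]; exact Submodule.smul_mem _ _ hx

lemma hom_br (l : List (Fin m)) : ∀ a : Fin m, Hom (l.length + 1) (io m (freeLieBracket m a l)) := by
  induction l with
  | nil => intro a; simpa [freeLieBracket] using hom_lt a
  | cons b t ih =>
    intro a
    rw [freeLieBracket, io_lie, io_of]
    have h1 := (hom_lt a).mul (ih b)
    have h2 := (ih b).mul (hom_lt a)
    rw [add_comm] at h1
    exact h1.sub h2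

lemma hom_io {n : ℕ} {z : FreeLieAlgebra ℚ (Fin m)} (hz : z ∈ freeLieHomog m n) :
    Hom n (io m z) := by
  induction hz using Submodule.span_induction with
  | mem x h =>
    obtain ⟨b, l, rfl, rfl⟩ := h
    exact hom_br l b
  | zero => intro w hw; simp at hw
  | add x y _ _ hx hy => rw [map_add]; exact hx.add hy
  | smul r x _ hx => rw [map_smul]; exact hx.smul r

/-! ### Dynkin operator -/

/-- Dynkin operator on words. -/
noncomputable def dyn : List (Fin m) → FreeLieAlgebra ℚ (Fin m)
  | [] => 0
  | a :: l => freeLieBracket m a l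

/-- Dynkin operator. -/
noncomputable def D (m : ℕ) : T m →ₗ[ℚ] FreeLieAlgebra ℚ (Fin m) :=
  Finsupp.linearCombination ℚ (fun w => dyn (toList w)) ∘ₗ
    (MonoidAlgebra.coeffLinearEquiv ℚ).toLinearMap

lemma D_single (w : FreeMonoid (Fin m)) (r : ℚ) :
    D m (MonoidAlgebra.single w r) = r • dyn (toList w) := by
  simp [D]

/-- Adjoint action of words. -/
noncomputable def adW (m : ℕ) : FreeMonoid (Fin m) →* Module.End ℚ (FreeLieAlgebra ℚ (Fin m)) :=
  FreeMonoid.lift (fun a => LieAlgebra.ad ℚ _ (FreeLieAlgebra.of ℚ a))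

/-- Adjoint action of the associative algebra. -/
noncomputable def adT (m : ℕ) : T m →ₐ[ℚ] Module.End ℚ (FreeLieAlgebra ℚ (Fin m)) :=
  MonoidAlgebra.lift ℚ _ _ (adW m)

lemma dyn_append (v : List (Fin m)) (hv : v ≠ []) (l : List (Fin m)) :
    dyn (l ++ v) = adW m (ofList l) (dyn v) := by
  induction l with
  | nil => simp
  | cons a l ih =>
    rw [FreeMonoid.ofList_cons, map_mul, Module.End.mul_apply, ← ih, List.cons_append]
    have : l ++ v ≠ [] := by simp [hv]
    obtain ⟨b, t, e⟩ := List.exists_cons_of_ne_nil this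
    rw [e, dyn, dyn, freeLieBracket]
    simp [adW]

lemma D_mul (s t : T m) : D m (s * t) = adT m s (D m t) + t.coeff 1 • D m s := by
  induction s using MonoidAlgebra.induction_linear with
  | zero => simp
  | add f g hf hg => 
    rw [add_mul, map_add, hf, hg, map_add, map_add, LinearMap.add_apply, smul_add]
    abel
  | single a r =>
    induction t using MonoidAlgebra.induction_linear with
    | zero => simp
    | add f g hf hg =>
      rw [mul_add, map_add, hf, hg, map_add, map_add, MonoidAlgebra.coeff_add, Finsupp.add_apply,
        add_smul]
      abel
    | single b r' =>
      rw [MonoidAlgebra.single_mul_single, D_single, D_single, D_single, adT,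
        MonoidAlgebra.lift_single, FreeMonoid.toList_mul, MonoidAlgebra.coeff_single]
      by_cases hb : b = 1
      · subst hb
        simp [dyn, smul_smul, mul_comm]
      · have : toList b ≠ [] := hb
        rw [dyn_append _ this]
        classical
        rw [Finsupp.single_apply, if_neg hb]
        simp [smul_smul, mul_comm]

lemma adT_io (z : FreeLieAlgebra ℚ (Fin m)) : adT m (io m z) = LieAlgebra.ad ℚ _ z := by
  have : ((adT m : T m →ₗ⁅ℚ⁆ Module.End ℚ (FreeLieAlgebra ℚ (Fin m))).comp (io m)) =
      LieAlgebra.ad ℚ (FreeLieAlgebra ℚ (Fin m)) := by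
    apply FreeLieAlgebra.hom_ext
    intro x
    simp [adT, lt, adW]
  exact LieHom.congr_fun this z

lemma D_br (l : List (Fin m)) : ∀ a : Fin m,
    D m (io m (freeLieBracket m a l)) = ((l.length + 1 : ℕ) : ℚ) • freeLieBracket m a l := by
  induction l with
  | nil => intro a; simp [freeLieBracket, lt, D_single, dyn]
  | cons b t ih =>
    intro a
    rw [freeLieBracket, io_lie, map_sub, D_mul, D_mul, adT_io, adT_io, ih b]
    have h1 : (io m (freeLieBracket m b t)).coeff 1 = 0 := by
      by_contra h
      have := hom_br t b [] h
      simp at this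
    have h2 : (io m (FreeLieAlgebra.of ℚ a)).coeff 1 = 0 := by
      by_contra h
      rw [io_of] at h
      have := hom_lt a [] h
      simp at this
    have h3 : D m (io m (FreeLieAlgebra.of ℚ a)) = FreeLieAlgebra.of ℚ a := by
      simp [lt, D_single, dyn, freeLieBracket]
    rw [h1, h2, h3]
    simp only [LieAlgebra.ad_apply, zero_smul, add_zero, lie_smul, List.length_cons]
    rw [← lie_skew (FreeLieAlgebra.of ℚ a) (freeLieBracket m b t)]
    push_cast
    module

lemma D_io {n : ℕ} {z : FreeLieAlgebra ℚ (Fin m)} (hz : z ∈ freeLieHomog m n) :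
    D m (io m z) = (n : ℚ) • z := by
  induction hz using Submodule.span_induction with
  | mem x h =>
    obtain ⟨b, l, rfl, rfl⟩ := h
    exact D_br l b
  | zero => simp
  | add x y _ _ hx hy => rw [map_add, map_add, hx, hy, smul_add]
  | smul r x _ hx => rw [map_smul, map_smul, hx, smul_comm]

lemma io_inj {n : ℕ} (hn : 0 < n) {z : FreeLieAlgebra ℚ (Fin m)} (hz : z ∈ freeLieHomog m n)
    (h : io m z = 0) : z = 0 := by
  have h1 := D_io hz
  rw [h, map_zero] at h1
  have : (n : ℚ) ≠ 0 := by positivity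
  exact (smul_eq_zero.mp h1.symm).resolve_left this

/-! ### Coproduct -/

/-- Coproduct. -/
noncomputable def De (m : ℕ) : T m →ₐ[ℚ] T2 m :=
  MonoidAlgebra.lift ℚ _ _ (FreeMonoid.lift (fun a =>
    MonoidAlgebra.single (FreeMonoid.of a, 1) 1 + MonoidAlgebra.single (1, FreeMonoid.of a) 1))

/-- Left inclusion. -/
noncomputable def i1 (m : ℕ) : T m →ₐ[ℚ] T2 m :=
  MonoidAlgebra.mapDomainAlgHom ℚ ℚ (MonoidHom.inl _ _)

/-- Right inclusion. -/
noncomputable def i2 (m : ℕ) : T m →ₐ[ℚ] T2 m :=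
  MonoidAlgebra.mapDomainAlgHom ℚ ℚ (MonoidHom.inr _ _)

lemma i1_single (w : FreeMonoid (Fin m)) (r : ℚ) :
    i1 m (MonoidAlgebra.single w r) = MonoidAlgebra.single (w, 1) r := by
  simp [i1]

lemma i2_single (w : FreeMonoid (Fin m)) (r : ℚ) :
    i2 m (MonoidAlgebra.single w r) = MonoidAlgebra.single (1, w) r := by
  simp [i2]

lemma i1_i2 (s t : T m) : i1 m s * i2 m t = i2 m t * i1 m s := by
  induction s using MonoidAlgebra.induction_linear with
  | zero => simp
  | add f g hf hg => rw [map_add, add_mul, mul_add, hf, hg]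
  | single a r =>
    induction t using MonoidAlgebra.induction_linear with
    | zero => simp
    | add f g hf hg => rw [map_add, add_mul, mul_add, hf, hg]
    | single b r' =>
      rw [i1_single, i2_single, MonoidAlgebra.single_mul_single, MonoidAlgebra.single_mul_single,
        mul_comm r]
      simp

/-- The primitive diagonal map. -/
noncomputable def prim (m : ℕ) : FreeLieAlgebra ℚ (Fin m) →ₗ⁅ℚ⁆ T2 m :=
  { toLinearMap := (i1 m).toLinearMap ∘ₗ (io m).toLinearMap + (i2 m).toLinearMap ∘ₗ (io m).toLinearMap
    map_lie' := by
      intro x y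
      have h1 := i1_i2 (io m x) (io m y)
      have h2 := i1_i2 (io m y) (io m x)
      simp [LieRing.of_associative_ring_bracket, mul_add, add_mul, h1, h2]
      abel }

lemma De_io (z : FreeLieAlgebra ℚ (Fin m)) : De m (io m z) = i1 m (io m z) + i2 m (io m z) := by
  have : ((De m : T m →ₗ⁅ℚ⁆ T2 m).comp (io m)) = prim m := by
    apply FreeLieAlgebra.hom_ext
    intro x
    have h1 : prim m (FreeLieAlgebra.of ℚ x) = i1 m (io m (FreeLieAlgebra.of ℚ x)) +
        i2 m (io m (FreeLieAlgebra.of ℚ x)) := rfl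
    rw [h1]
    simp [De, lt, i1_single, i2_single]
  exact LieHom.congr_fun this z

lemma i1_coeff (t : T m) (u v : FreeMonoid (Fin m)) (hv : v ≠ 1) : (i1 m t).coeff (u, v) = 0 := by
  classical
  induction t using MonoidAlgebra.induction_linear with
  | zero => simp
  | add f g hf hg => simp [hf, hg]
  | single a r => simp [i1_single, Finsupp.single_apply, hv.symm]

lemma i2_coeff (t : T m) (u v : FreeMonoid (Fin m)) (hu : u ≠ 1) : (i2 m t).coeff (u, v) = 0 := by
  classical
  induction t using MonoidAlgebra.induction_linear with
  | zero => simp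
  | add f g hf hg => simp [hf, hg]
  | single a r => simp [i2_single, Finsupp.single_apply, hu.symm]

lemma De_word (w : List (Fin m)) : De m (MonoidAlgebra.single (ofList w) 1) =
    ((splits w).map (fun p => (MonoidAlgebra.single (ofList p.1, ofList p.2) (1 : ℚ) : T2 m))).sum := by
  induction w with
  | nil =>
    have : (MonoidAlgebra.single (ofList []) 1 : T m) = 1 := rfl
    rw [this, map_one]
    simp [splits]
    rfl
  | cons a w ih =>
    have : (MonoidAlgebra.single (ofList (a :: w)) 1 : T m) =
        lt a * MonoidAlgebra.single (ofList w) 1 := by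
      rw [lt, MonoidAlgebra.single_mul_single, FreeMonoid.ofList_cons, one_mul]
    rw [this, map_mul, ih]
    have h : De m (lt a) = MonoidAlgebra.single (FreeMonoid.of a, 1) 1 +
        MonoidAlgebra.single (1, FreeMonoid.of a) 1 := by
      simp [De, lt]
    rw [h, add_mul, ← List.sum_map_mul_left, ← List.sum_map_mul_left, splits, List.map_append,
      List.sum_append, List.map_map, List.map_map]
    simp [Function.comp_def, MonoidAlgebra.single_mul_single, FreeMonoid.ofList_cons]

lemma De_coeff (w : List (Fin m)) (u v : List (Fin m)) :
    (De m (MonoidAlgebra.single (ofList w) 1)).coeff (ofList u, ofList v) =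
      ((splits w).count (u, v) : ℚ) := by
  classical
  rw [De_word]
  induction splits w with
  | nil => simp
  | cons p l ih =>
    rw [List.map_cons, List.sum_cons, MonoidAlgebra.coeff_add, Finsupp.add_apply, ih,
      List.count_cons, MonoidAlgebra.coeff_single, Finsupp.single_apply, add_comm]
    push_cast
    congr 1
    by_cases h : p = (u, v)
    · simp [h]
    · have : ¬ ((ofList p.1, ofList p.2) = (ofList u, ofList v)) := by
        intro h'
        apply h
        simp at h'
        exact Prod.ext h'.1 h'.2
      simp [h]
      intro h1 h2
      exact h (Prod.ext h1 h2)

lemma De_coeff' (t : T m) (u v : List (Fin m)) :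
    (De m t).coeff (ofList u, ofList v) =
      t.coeff.sum (fun w r => r * ((splits (toList w)).count (u, v) : ℚ)) := by
  induction t using MonoidAlgebra.induction_linear with
  | zero => simp
  | add f g hf hg =>
    rw [map_add, MonoidAlgebra.coeff_add, Finsupp.add_apply, hf, hg, MonoidAlgebra.coeff_add,
      Finsupp.sum_add_index']
    · simp
    · intros; ring
  | single w r =>
    have : (MonoidAlgebra.single w r : T m) = r • MonoidAlgebra.single (ofList (toList w)) 1 := by
      simp
    rw [this, map_smul, MonoidAlgebra.coeff_smul_apply, De_coeff]
    simp

/-- The smallest word of a Lie element is Lyndon. -/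
lemma min_lyndon {n : ℕ} (hn : 0 < n) {z : FreeLieAlgebra ℚ (Fin m)} (hz : z ∈ freeLieHomog m n)
    (w : List (Fin m)) (hw : cf w (io m z) ≠ 0) (hmin : ∀ w', cf w' (io m z) ≠ 0 → w ≤ w') :
    IsLyndon w := by
  by_contra hL
  have hlen := hom_io hz w hw
  have h0 : w ≠ [] := by
    rintro rfl
    simp at hlen
    omega
  obtain ⟨u, v, hu, hv, e, hsh⟩ := exists_shuffle h0 hL
  have h1 := De_coeff' (io m z) u v
  rw [De_io, MonoidAlgebra.coeff_add, Finsupp.add_apply, i1_coeff _ _ (ofList v) hv,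
    i2_coeff _ (ofList u) _ hu,
    Finsupp.sum, Finset.sum_eq_single (ofList w)] at h1
  · have h2 : 0 < (splits w).count (u, v) := by
      rw [List.count_pos_iff, e]
      exact splits_append u v
    have h3 : ((splits w).count (u, v) : ℚ) ≠ 0 := by positivity
    rw [add_zero] at h1
    rcases mul_eq_zero.mp h1.symm with h | h
    · exact hw h
    · exact h3 h
  · intro b hb hne
    have hb' : cf (toList b) (io m z) ≠ 0 := by simpa [cf_apply] using hb
    have h2 : (splits (toList b)).count (u, v) = 0 := by
      rw [List.count_eq_zero]
      intro hmem
      have e' : toList b = w := le_antisymm (hsh _ hmem) (hmin _ hb')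
      exact hne e'
    rw [h2]
    simp
  · intro h
    exact absurd (by simpa [cf_apply] using hw) h

/-- Leading word. -/
def Lead (u : List (Fin m)) (t : T m) : Prop := cf u t = 1 ∧ ∀ w, cf w t ≠ 0 → u ≤ w

lemma Lead.mul {u v : List (Fin m)} {s t : T m} (hs : Hom u.length s) (ht : Hom v.length t)
    (h1 : Lead u s) (h2 : Lead v t) : Lead (u ++ v) (s * t) := by
  refine ⟨by rw [cf_mul hs t u v rfl, h1.1, h2.1, one_mul], fun w hw => ?_⟩
  have hl := (hs.mul ht) w hw
  obtain ⟨a, b, rfl, ha⟩ : ∃ a b, w = a ++ b ∧ a.length = u.length :=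
    ⟨w.take u.length, w.drop u.length, by simp, by simp; omega⟩
  rw [cf_mul hs t a b ha] at hw
  have h3 := h1.2 a (left_ne_zero_of_mul hw)
  have h4 := h2.2 b (right_ne_zero_of_mul hw)
  rcases lt_or_eq_of_le h3 with h | rfl
  · exact le_of_lt (lt_app_of_length_le h (by omega) _ _)
  · rcases lt_or_eq_of_le h4 with h | rfl
    · exact le_of_lt ((app_lt_iff _).mpr h)
    · exact le_rfl

lemma exists_lead (n : ℕ) : ∀ w : List (Fin m), w.length = n → IsLyndon w →
    ∃ z ∈ freeLieHomog m n, Lead w (io m z) := by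
  induction n using Nat.strong_induction_on with
  | _ n ih =>
    intro w hl hw
    by_cases h2 : 2 ≤ w.length
    · obtain ⟨u, v, e, hu, hv, hlt⟩ := hw.factor h2
      have hul := List.length_pos_iff.mpr hu.1
      have hvl := List.length_pos_iff.mpr hv.1
      have hln : u.length + v.length = n := by rw [← hl, e, List.length_append]
      obtain ⟨y, hy, hy'⟩ := ih u.length (by omega) u rfl hu
      obtain ⟨z, hz, hz'⟩ := ih v.length (by omega) v rfl hv
      refine ⟨⁅y, z⁆, by rw [← hln]; exact lie_mem hy hz, ?_⟩
      have h3 := Lead.mul (hom_io hy) (hom_io hz) hy' hz'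
      have h4 := Lead.mul (hom_io hz) (hom_io hy) hz' hy'
      have h5 : ∀ w', cf w' (io m z * io m y) ≠ 0 → u ++ v < w' := fun w' hw' =>
        lt_of_lt_of_le hlt (h4.2 w' hw')
      rw [io_lie, e]
      constructor
      · have : cf (u ++ v) (io m z * io m y) = 0 := by
          by_contra h
          exact lt_irrefl _ (h5 _ h)
        rw [map_sub, h3.1, this, sub_zero]
      · intro w' hw'
        rw [map_sub] at hw'
        by_cases h : cf w' (io m y * io m z) = 0
        · refine le_of_lt (h5 w' ?_)
          intro h'
          simp [h, h'] at hw'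
        · exact h3.2 w' h
    · have := List.length_pos_iff.mpr hw.1
      obtain ⟨a, rfl⟩ := List.length_eq_one_iff.mp (show w.length = 1 by omega)
      subst hl
      refine ⟨FreeLieAlgebra.of ℚ a, br_mem a [], ?_⟩
      rw [io_of]
      refine ⟨by simp [cf_lt], fun w' hw' => ?_⟩
      rw [cf_lt] at hw'
      split_ifs at hw' with h
      · rw [h]
      · simp at hw'

abbrev Lyn (m n : ℕ) := {w : List (Fin m) // w.length = n ∧ IsLyndon w}

instance (m n : ℕ) : Finite (Lyn m n) :=
  Set.Finite.subset (List.finite_length_eq (Fin m) n) (fun _ h => h.1)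

theorem finrank_eq (m n : ℕ) (hn : 0 < n) :
    Module.finrank ℚ (freeLieHomog m n) = Nat.card (Lyn m n) := by
  classical
  have := Fintype.ofFinite (Lyn m n)
  rw [Nat.card_eq_fintype_card]
  let φ : freeLieHomog m n →ₗ[ℚ] (Lyn m n → ℚ) :=
    LinearMap.pi (fun w => cf w.1) ∘ₗ (io m).toLinearMap ∘ₗ (freeLieHomog m n).subtype
  have hφ : Function.Injective φ := by
    rw [← LinearMap.ker_eq_bot, LinearMap.ker_eq_bot']
    rintro ⟨z, hz⟩ h
    by_contra hne
    have hio : io m z ≠ 0 := by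
      intro h'
      apply hne
      have := io_inj hn hz h'
      simpa using this
    obtain ⟨w0, hw0⟩ := exists_cf_ne hio
    obtain ⟨w, hw, hmin⟩ := ((io m z).coeff.support.image toList).exists_min_image id
      ⟨w0, Finset.mem_image.mpr ⟨ofList w0, by simpa [cf_apply] using hw0, rfl⟩⟩
    have hw' : cf w (io m z) ≠ 0 := by
      obtain ⟨w', h1, rfl⟩ := Finset.mem_image.mp hw
      simpa [cf_apply] using h1
    have hL := min_lyndon hn hz w hw' (fun w' h' => hmin w'
      (Finset.mem_image.mpr ⟨ofList w', by simpa [cf_apply] using h', rfl⟩))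
    exact hw' (congrFun h ⟨w, hom_io hz w hw', hL⟩)
  have hfin : Module.Finite ℚ (freeLieHomog m n) := Module.Finite.of_injective φ hφ
  apply le_antisymm
  · have := LinearMap.finrank_le_finrank_of_injective hφ
    simpa using this
  · choose b hb hb' using fun w : Lyn m n => exists_lead n w.1 w.2.1 w.2.2
    have hli : LinearIndependent ℚ (fun w => (⟨b w, hb w⟩ : freeLieHomog m n)) := by
      rw [Fintype.linearIndependent_iff]
      intro g hg
      by_contra! hc
      obtain ⟨i0, hi0⟩ := hc
      obtain ⟨w, hw, hmin⟩ := (Finset.univ.filter (fun i => g i ≠ 0)).exists_min_image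
        (fun i : Lyn m n => i.1) ⟨i0, by simpa using hi0⟩
      have h1 := congrFun (congrArg φ hg) w
      rw [map_sum, map_zero, Finset.sum_apply, Finset.sum_eq_single w] at h1
      · rw [map_smul] at h1
        have h2 : φ ⟨b w, hb w⟩ w = 1 := (hb' w).1
        rw [Pi.smul_apply, h2] at h1
        simp at h1 hw
        exact hw h1
      · intro w' _ hne
        rw [map_smul, Pi.smul_apply]
        by_cases hg' : g w' = 0
        · simp [hg']
        · have hle : w.1 ≤ w'.1 := hmin w' (by simpa using hg')
          have h2 : φ ⟨b w', hb w'⟩ w = 0 := by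
            by_contra h3
            have := (hb' w').2 w.1 h3
            exact hne (Subtype.ext (le_antisymm this hle))
          rw [h2, smul_zero]
      · simp
    exact hli.fintype_card_le_finrank

end Alg
end WittAux
namespace WittAux

section Count

open Function

variable {m : ℕ}

/-- Shift. -/
def sh (x : ℕ → Fin m) : ℕ → Fin m := fun i => x (i + 1)

lemma sh_iter (k : ℕ) (x : ℕ → Fin m) (i : ℕ) : sh^[k] x i = x (i + k) := by
  induction k generalizing x with
  | zero => rfl
  | succ k ih =>
    rw [Function.iterate_succ_apply, ih]
    simp [sh, add_assoc]

/-- Prefix of length `d`. -/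
def word (d : ℕ) (x : ℕ → Fin m) : List (Fin m) := (List.range d).map x

@[simp] lemma word_length (d : ℕ) (x : ℕ → Fin m) : (word d x).length = d := by simp [word]

lemma word_add (k j : ℕ) (x : ℕ → Fin m) : word (k + j) x = word k x ++ word j (sh^[k] x) := by
  simp only [word, List.range_add, List.map_append, List.map_map]
  congr 1
  apply List.map_congr_left
  intro i _
  simp [sh_iter, add_comm]

lemma periodic_iff {d : ℕ} {x : ℕ → Fin m} : IsPeriodicPt sh d x ↔ Function.Periodic x d := by
  constructor
  · intro h i
    have h : sh^[d] x = x := h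
    have h' := congrFun h i
    rw [sh_iter] at h'
    exact h'
  · intro h
    funext i
    rw [sh_iter, h i]

lemma word_inj {d : ℕ} (hd : 0 < d) {x y : ℕ → Fin m} (hx : IsPeriodicPt sh d x)
    (hy : IsPeriodicPt sh d y) (h : word d x = word d y) : x = y := by
  rw [periodic_iff] at hx hy
  funext i
  rw [← hx.map_mod_nat, ← hy.map_mod_nat]
  simp only [word, List.map_inj_left, List.mem_range] at h
  exact h _ (Nat.mod_lt _ hd)

lemma lyndon_word_iff {d : ℕ} (hd : 0 < d) {y : ℕ → Fin m} (hy : IsPeriodicPt sh d y) :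
    IsLyndon (word d y) ↔ ∀ k, 0 < k → k < d → word d y < word d (sh^[k] y) := by
  have key : ∀ k j, k + j = d → word d (sh^[k] y) = word j (sh^[k] y) ++ word k y := by
    intro k j e
    have h : sh^[j] (sh^[k] y) = y := by
      rw [← Function.iterate_add_apply, add_comm, e]
      exact hy
    rw [← e, add_comm, word_add, h]
  rw [isLyndon_iff]
  constructor
  · rintro ⟨_, h⟩ k hk hkd
    obtain ⟨j, rfl⟩ := Nat.exists_eq_add_of_lt hkd
    have h1 := h (word k y) (word (j + 1) (sh^[k] y)) (by rw [← word_add, add_assoc])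
      (by rw [← List.length_pos_iff]; simpa using hk) (by rw [← List.length_pos_iff]; simp)
    rw [key k (j + 1) (by omega), add_assoc, word_add]
    exact h1
  · intro h
    refine ⟨by rw [← List.length_pos_iff]; simpa using hd, fun u v e hu hv => ?_⟩
    have hl : u.length + v.length = d := by
      rw [← List.length_append, ← e, word_length]
    have hu' := List.length_pos_iff.mpr hu
    have hv' := List.length_pos_iff.mpr hv
    have h1 := h u.length hu' (by omega)
    have e2 : word u.length y ++ word v.length (sh^[u.length] y) = u ++ v := by
      rw [← word_add, hl, e]
    obtain ⟨e3, e4⟩ := List.append_inj e2 (by simp)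
    rw [key u.length v.length hl, e3, e4, e] at h1
    exact h1

/-- Points of minimal period `d`. -/
abbrev Ed (m d : ℕ) := {x : ℕ → Fin m // minimalPeriod sh x = d}

lemma Ed_per {d : ℕ} {x : ℕ → Fin m} (h : minimalPeriod sh x = d) : IsPeriodicPt sh d x := by
  rw [← h]
  exact isPeriodicPt_minimalPeriod _ _

lemma per_iter {d : ℕ} {x : ℕ → Fin m} (h : IsPeriodicPt sh d x) (k : ℕ) :
    IsPeriodicPt sh d (sh^[k] x) := h.apply_iterate k

lemma exists_lyndon {d : ℕ} (hd : 0 < d) {x : ℕ → Fin m} (hx : minimalPeriod sh x = d) :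
    ∃ i < d, IsLyndon (word d (sh^[i] x)) := by
  have hp := Ed_per hx
  obtain ⟨i, hi, hmin⟩ := (Finset.range d).exists_min_image (fun i => word d (sh^[i] x))
    ⟨0, by simpa using hd⟩
  simp only [Finset.mem_range] at hi hmin
  refine ⟨i, hi, (lyndon_word_iff hd (per_iter hp i)).mpr ?_⟩
  intro k hk hkd
  rw [← Function.iterate_add_apply]
  have e : sh^[(k + i) % d] x = sh^[k + i] x := by
    rw [← hx]
    exact iterate_mod_minimalPeriod_eq
  have hlt : (k + i) % d < d := Nat.mod_lt _ hd
  rw [← e]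
  refine lt_of_le_of_ne (hmin _ hlt) ?_
  intro h
  have h1 := word_inj hd (per_iter hp i) (per_iter hp _) h
  have h2 := (iterate_eq_iterate_iff_of_lt_minimalPeriod (by rwa [hx]) (by rwa [hx])).mp h1
  rcases lt_or_ge (k + i) d with h3 | h3
  · rw [Nat.mod_eq_of_lt h3] at h2
    omega
  · rw [Nat.mod_eq_sub_mod h3, Nat.mod_eq_of_lt (by omega)] at h2
    omega

lemma unique_lyndon_aux {d : ℕ} (hd : 0 < d) {x : ℕ → Fin m} (hp : IsPeriodicPt sh d x)
    {i j : ℕ} (hij : i < j) (hj : j < d)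
    (h1 : IsLyndon (word d (sh^[i] x))) (h2 : IsLyndon (word d (sh^[j] x))) : False := by
  have a := (lyndon_word_iff hd (per_iter hp i)).mp h1 (j - i) (by omega) (by omega)
  have b := (lyndon_word_iff hd (per_iter hp j)).mp h2 (d - (j - i)) (by omega) (by omega)
  rw [← Function.iterate_add_apply] at a b
  have e1 : j - i + i = j := by omega
  have e2 : d - (j - i) + j = i + d := by omega
  have e3 : sh^[i + d] x = sh^[i] x := by
    rw [Function.iterate_add_apply, hp]
  rw [e1] at a
  rw [e2, e3] at b
  exact lt_asymm a b

lemma unique_lyndon {d : ℕ} (hd : 0 < d) {x : ℕ → Fin m} (hp : IsPeriodicPt sh d x)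
    {i j : ℕ} (hi : i < d) (hj : j < d)
    (h1 : IsLyndon (word d (sh^[i] x))) (h2 : IsLyndon (word d (sh^[j] x))) : i = j := by
  rcases lt_trichotomy i j with h | h | h
  · exact (unique_lyndon_aux hd hp h hj h1 h2).elim
  · exact h
  · exact (unique_lyndon_aux hd hp h hi h2 h1).elim

/-- Periodic extension. -/
def ext {d : ℕ} (hd : 0 < d) (l : List (Fin m)) (hl : l.length = d) : ℕ → Fin m :=
  fun j => l[j % d]'(by rw [hl]; exact Nat.mod_lt _ hd)

lemma ext_per {d : ℕ} (hd : 0 < d) (l : List (Fin m)) (hl : l.length = d) :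
    IsPeriodicPt sh d (ext hd l hl) := by
  rw [periodic_iff]
  intro i
  simp [ext]

lemma word_ext {d : ℕ} (hd : 0 < d) (l : List (Fin m)) (hl : l.length = d) :
    word d (ext hd l hl) = l := by
  apply List.ext_getElem
  · simp [hl]
  · intro i h1 h2
    simp only [word, List.getElem_map, List.getElem_range, ext]
    congr 1
    exact Nat.mod_eq_of_lt (by simpa using h1)

lemma minPer_of_lyndon {d : ℕ} (hd : 0 < d) {y : ℕ → Fin m} (hy : IsPeriodicPt sh d y)
    (h : IsLyndon (word d y)) : minimalPeriod sh y = d := by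
  by_contra hne
  have h1 := hy.minimalPeriod_pos hd
  have h2 := hy.minimalPeriod_le hd
  have h3 := (lyndon_word_iff hd hy).mp h _ h1 (by omega)
  rw [iterate_minimalPeriod] at h3
  exact lt_irrefl _ h3

lemma card_Ed {d : ℕ} (hd : 0 < d) : Nat.card (Ed m d) = d * Nat.card (Lyn m d) := by
  have hlyn : ∀ l : Lyn m d, IsLyndon (word d (ext hd l.1 l.2.1)) := by
    intro l
    rw [word_ext]
    exact l.2.2
  have hE : ∀ (i : ℕ) (l : Lyn m d), minimalPeriod sh (sh^[d - i] (ext hd l.1 l.2.1)) = d := by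
    intro i l
    rw [minimalPeriod_apply_iterate]
    · exact minPer_of_lyndon hd (ext_per hd _ _) (hlyn l)
    · exact ⟨d, hd, ext_per hd _ _⟩
  have hback : ∀ (i : Fin d) (l : Lyn m d),
      sh^[i.1] (sh^[d - i.1] (ext hd l.1 l.2.1)) = ext hd l.1 l.2.1 := by
    intro i l
    rw [← Function.iterate_add_apply, show i.1 + (d - i.1) = d by omega]
    exact ext_per hd _ _
  let f : Fin d × Lyn m d → Ed m d := fun p => ⟨sh^[d - p.1.1] (ext hd p.2.1 p.2.2.1), hE _ _⟩
  have hf : Bijective f := by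
    constructor
    · rintro ⟨i, l⟩ ⟨j, l'⟩ h
      have h : sh^[d - i.1] (ext hd l.1 l.2.1) = sh^[d - j.1] (ext hd l'.1 l'.2.1) :=
        congrArg Subtype.val h
      have hi := hback i l
      have hj := hback j l'
      rw [← h] at hj
      have hp : IsPeriodicPt sh d (sh^[d - i.1] (ext hd l.1 l.2.1)) :=
        per_iter (ext_per hd _ _) _
      have hij : i = j := by
        apply Fin.ext
        apply unique_lyndon hd hp i.2 j.2
        · rw [hi]; exact hlyn l
        · rw [hj]; exact hlyn l'
      subst hij
      rw [hi] at hj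
      have := congrArg (word d) hj
      rw [word_ext, word_ext] at this
      rw [Subtype.ext this]
    · rintro ⟨x, hx⟩
      obtain ⟨i, hi, hL⟩ := exists_lyndon hd hx
      refine ⟨⟨⟨i, hi⟩, ⟨_, word_length _ _, hL⟩⟩, Subtype.ext ?_⟩
      have hp := Ed_per hx
      have e : ext hd (word d (sh^[i] x)) (word_length _ _) = sh^[i] x :=
        word_inj hd (ext_per hd _ _) (per_iter hp i) (word_ext _ _ _)
      change sh^[d - i] (ext hd (word d (sh^[i] x)) (word_length _ _)) = x
      rw [e, ← Function.iterate_add_apply, show d - i + i = d by omega]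
      exact hp
  rw [← Nat.card_eq_of_bijective f hf, Nat.card_prod, Nat.card_fin]

lemma card_Per {n : ℕ} (hn : 0 < n) :
    Nat.card {x : ℕ → Fin m // IsPeriodicPt sh n x} = m ^ n := by
  let f : {x : ℕ → Fin m // IsPeriodicPt sh n x} → List.Vector (Fin m) n :=
    fun x => ⟨word n x.1, word_length _ _⟩
  have hf : Bijective f := by
    constructor
    · intro x y h
      exact Subtype.ext (word_inj hn x.2 y.2 (congrArg Subtype.val h))
    · rintro ⟨l, hl⟩
      exact ⟨⟨ext hn l hl, ext_per hn l hl⟩, Subtype.ext (word_ext hn l hl)⟩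
  rw [Nat.card_eq_of_bijective f hf, Nat.card_eq_fintype_card, card_vector, Fintype.card_fin]

lemma finite_Per {n : ℕ} (hn : 0 < n) :
    Finite {x : ℕ → Fin m // IsPeriodicPt sh n x} := by
  let f : {x : ℕ → Fin m // IsPeriodicPt sh n x} → List.Vector (Fin m) n :=
    fun x => ⟨word n x.1, word_length _ _⟩
  have : Finite (List.Vector (Fin m) n) := Finite.of_fintype _
  exact Finite.of_injective f
    (fun x y h => Subtype.ext (word_inj hn x.2 y.2 (congrArg Subtype.val h)))

lemma sum_lyndon {n : ℕ} (hn : 0 < n) :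
    ∑ d ∈ n.divisors, d * Nat.card (Lyn m d) = m ^ n := by
  classical
  have := finite_Per (m := m) hn
  have hS : {x : ℕ → Fin m | IsPeriodicPt sh n x}.Finite := this
  have h1 : hS.toFinset.card = m ^ n := by
    rw [← card_Per (m := m) hn]
    exact (Nat.card_eq_card_finite_toFinset hS).symm
  rw [← h1, Finset.card_eq_sum_card_fiberwise (f := fun x => minimalPeriod sh x) (t := n.divisors)]
  · apply Finset.sum_congr rfl
    intro d hd
    rw [← card_Ed (Nat.pos_of_mem_divisors hd), ← Nat.card_eq_finsetCard]
    apply Nat.card_congr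
    apply Equiv.subtypeEquivRight
    intro x
    simp only [Finset.mem_filter, Set.Finite.mem_toFinset, Set.mem_setOf_eq]
    constructor
    · intro h
      refine ⟨?_, h⟩
      rw [isPeriodicPt_iff_minimalPeriod_dvd, h]
      exact Nat.dvd_of_mem_divisors hd
    · exact fun h => h.2
  · intro x hx
    have hx : IsPeriodicPt sh n x := by simpa using hx
    simp only [Finset.mem_coe, Nat.mem_divisors]
    exact ⟨hx.minimalPeriod_dvd, hn.ne'⟩

theorem witt_count (m n : ℕ) (hn : 0 < n) :
    (n : ℤ) * (Nat.card (Lyn m n) : ℤ) =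
      ∑ d ∈ n.divisors, ArithmeticFunction.moebius d * (m : ℤ) ^ (n / d) := by
  have h := (ArithmeticFunction.sum_eq_iff_sum_mul_moebius_eq
    (f := fun d => (d : ℤ) * (Nat.card (Lyn m d) : ℤ)) (g := fun d => (m : ℤ) ^ d)).mp (by
      intro n hn
      have := sum_lyndon (m := m) hn
      exact_mod_cast this) n hn
  simp only [Int.cast_id] at h
  rw [← h, Nat.sum_divisorsAntidiagonal (f := fun a b =>
    ArithmeticFunction.moebius a * (m : ℤ) ^ b)]

end Count
end WittAux

/-- Witt's formula: the bracket-length-`n` component of the free Lie algebra over `ℚ` on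
an `m`-dimensional vector space (concentrated in a single even degree) has dimension
`(1/n) ∑_{d ∣ n} μ(d) m^{n/d}`. -/
theorem witt_formula (m n : ℕ) (hn : 0 < n) :
    (n : ℤ) * (Module.finrank ℚ (freeLieHomog m n) : ℤ) =
      ∑ d ∈ n.divisors, ArithmeticFunction.moebius d * (m : ℤ) ^ (n / d) := by
  rw [WittAux.finrank_eq m n hn]
  exact WittAux.witt_count m n hn
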